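/- Under the stated hypotheses, v is twice differentiable on (0,b) with v′(p) = −(1−b)/(2b·√(2r)·(1−p)²·φ(√(2r)·v(p))) for every p ∈ (0,b) (in particular v′ < 0), and v satisfies the nonlinear ordinary differential equation v″(p)/(2·v′(p)) − 1/(1−p) − r·v(p)·v′(p) = 0 for every p ∈ (0,b). -/

import Mathlib

/-- The standard normal density `φ(z) = exp(-z²/2)/√(2π)`. -/
noncomputable def npdf (z : ℝ) : ℝ := (Real.sqrt (2 * Real.pi))⁻¹ * Real.exp (-z ^ 2 / 2)

/-- The standard normal distribution function `Φ(y) = ∫_{-∞}^y φ(z) dz`. -/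
noncomputable def ncdf (y : ℝ) : ℝ := ∫ z in Set.Iic y, npdf z

/-- The standard normal tail function `Ψ(y) = 1 - Φ(y)`. -/
noncomputable def ntail (y : ℝ) : ℝ := 1 - ncdf y

/-- The function `F(y) = φ(y) - y·Ψ(y)`. -/
noncomputable def Fstat (y : ℝ) : ℝ := npdf y - y * ntail y


theorem npdf_pos_aux (z : ℝ) : 0 < npdf z := by
  unfold npdf
  have := Real.pi_pos
  positivity

theorem npdf_hasDerivAt_aux (z : ℝ) : HasDerivAt npdf (-z * npdf z) z := by
  have h1 : HasDerivAt (fun x : ℝ => -x ^ 2 / 2) (-z) z := by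
    have := ((hasDerivAt_pow 2 z).neg).div_const 2
    exact this.congr_deriv (by norm_num; ring)
  have h2 := (h1.exp).const_mul ((Real.sqrt (2 * Real.pi))⁻¹)
  have h3 : HasDerivAt npdf _ z := h2
  refine h3.congr_deriv ?_
  unfold npdf
  ring

theorem npdf_continuous_aux : Continuous npdf :=
  continuous_iff_continuousAt.2 fun z => (npdf_hasDerivAt_aux z).continuousAt

theorem npdf_integrable_aux : MeasureTheory.Integrable npdf := by
  have h := (integrable_exp_neg_mul_sq (b := 1 / 2) (by norm_num)).const_mul
    ((Real.sqrt (2 * Real.pi))⁻¹)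
  convert h using 1
  funext z
  unfold npdf
  congr 2
  ring

theorem ntail_hasStrictDerivAt_aux (y : ℝ) : HasStrictDerivAt ntail (-npdf y) y := by
  have h := (npdf_continuous_aux.integral_hasStrictDerivAt 0 y).const_sub (1 - ncdf 0)
  refine h.congr_of_eventuallyEq (Filter.Eventually.of_forall fun x => ?_)
  have := intervalIntegral.integral_Iic_sub_Iic (a := 0) (b := x)
    npdf_integrable_aux.integrableOn npdf_integrable_aux.integrableOn
  beta_reduce
  rw [← this]
  unfold ntail ncdf
  ring

theorem ntail_injective_aux : Function.Injective ntail := by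
  have : StrictAnti ntail := strictAnti_of_deriv_neg fun x => by
    rw [(ntail_hasStrictDerivAt_aux x).hasDerivAt.deriv]
    exact neg_lt_zero.2 (npdf_pos_aux x)
  exact this.injective

/-- v is twice differentiable on (0,b), with
v′(p) = −(1−b)/(2b√(2r)(1−p)²φ(√(2r)v(p))) < 0, and satisfies the ODE
v″/(2v′) − 1/(1−p) − r·v·v′ = 0 on (0,b). -/
theorem v_ode (r b : ℝ) (v : ℝ → ℝ) (hr : 0 < r) (hb : b ∈ Set.Ioo (0:ℝ) 1)
    (hv : ∀ p ∈ Set.Ioo (0:ℝ) b, 0 < v p ∧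
      ntail (Real.sqrt (2*r) * v p) = (1 - b) * p / (2 * b * (1 - p))) :
    ∃ v' v'' : ℝ → ℝ,
      (∀ p ∈ Set.Ioo (0:ℝ) b, HasDerivAt v (v' p) p) ∧
      (∀ p ∈ Set.Ioo (0:ℝ) b, HasDerivAt v' (v'' p) p) ∧
      (∀ p ∈ Set.Ioo (0:ℝ) b,
        v' p = -(1 - b) / (2 * b * Real.sqrt (2*r) * (1 - p) ^ 2
          * npdf (Real.sqrt (2*r) * v p)) ∧
        v' p < 0 ∧
        v'' p / (2 * v' p) - 1 / (1 - p) - r * v p * v' p = 0) := by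
  obtain ⟨hb0, hb1⟩ := hb
  set s := Real.sqrt (2 * r) with hs
  have hspos : 0 < s := Real.sqrt_pos.2 (by linarith)
  have hs2 : s ^ 2 = 2 * r := Real.sq_sqrt (by linarith)
  set v' : ℝ → ℝ := fun p => -(1 - b) / (2 * b * s * (1 - p) ^ 2 * npdf (s * v p)) with hv'
  have hneg : ∀ p ∈ Set.Ioo (0:ℝ) b, v' p < 0 := by
    intro p hp
    have h1 : 0 < 1 - p := by linarith [hp.2]
    have := npdf_pos_aux (s * v p)
    exact div_neg_of_neg_of_pos (by linarith) (by positivity)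
  have hd : ∀ p ∈ Set.Ioo (0:ℝ) b, HasDerivAt v (v' p) p := by
    intro p hp
    have h1 : 0 < 1 - p := by linarith [hp.2]
    have hpos := npdf_pos_aux (s * v p)
    have hinv : HasStrictDerivAt (Function.invFun ntail) (-npdf (s * v p))⁻¹
        (ntail (s * v p)) :=
      (ntail_hasStrictDerivAt_aux (s * v p)).to_local_left_inverse (neg_ne_zero.2 hpos.ne')
        (Filter.Eventually.of_forall (Function.leftInverse_invFun ntail_injective_aux))
    have hg : HasDerivAt (fun q : ℝ => (1 - b) * q / (2 * b * (1 - q)))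
        ((1 - b) / (2 * b * (1 - p) ^ 2)) p := by
      have := ((hasDerivAt_id p).const_mul (1 - b)).div
        (((hasDerivAt_id p).const_sub 1).const_mul (2 * b)) (by simp only [id]; positivity)
      refine HasDerivAt.congr_deriv this ?_
      simp only [id]
      field_simp
      ring
    rw [(hv p hp).2] at hinv
    have hc := (hinv.hasDerivAt.comp p hg).const_mul s⁻¹
    have hc2 : HasDerivAt v _ p := hc.congr_of_eventuallyEq (by
      filter_upwards [Ioo_mem_nhds hp.1 hp.2] with q hq
      simp only [Function.comp]
      rw [← (hv q hq).2, Function.leftInverse_invFun ntail_injective_aux]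
      field_simp)
    refine hc2.congr_deriv ?_
    simp only [hv']
    field_simp
  refine ⟨v', fun p => v' p * (2 / (1 - p) + 2 * r * v p * v' p), hd, ?_, ?_⟩
  · intro p hp
    have h1 : 0 < 1 - p := by linarith [hp.2]
    have hpos := npdf_pos_aux (s * v p)
    have hn := (npdf_hasDerivAt_aux (s * v p)).comp p ((hd p hp).const_mul s)
    have hden := ((((hasDerivAt_id p).const_sub 1).pow 2).const_mul (2 * b * s)).mul hn
    have hq := (hasDerivAt_const p (-(1 - b))).div hden (by
      simp only [id, Function.comp, Pi.mul_apply, Pi.pow_apply]; positivity)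
    have hq2 : HasDerivAt v' _ p := hq
    refine hq2.congr_deriv ?_
    have he : v' p = -(1 - b) / (2 * b * s * (1 - p) ^ 2 * npdf (s * v p)) := rfl
    simp only [id, Function.comp, Pi.mul_apply, Pi.pow_apply]
    rw [← hs2]
    generalize v' p = w at *
    have hb' : -(1 - b) = w * (2 * b * s * (1 - p) ^ 2 * npdf (s * v p)) := by
      rw [he]; field_simp
    rw [hb']
    field_simp
    ring
  · intro p hp
    have h1 : 0 < 1 - p := by linarith [hp.2]
    refine ⟨rfl, hneg p hp, ?_⟩
    have := (hneg p hp).ne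
    beta_reduce
    generalize v' p = w at *
    field_simp
    ring
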